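/- arXiv:1707.03693 — 6 statements merged into one kernel-verified Lean document; each statement's English description precedes it below -/
import Mathlib

section
/- For any 3-restricted semi-Segal type, the canonical projection φ₃ : Λ³₁ → Sp³ from the type of Λ³₁-horns to the type of 3-spines, which discards all components except the four points and the three consecutive edges x₀₁, x₁₂, x₂₃, is an equivalence of types. -/
set_option autoImplicit false
set_option linter.unusedVariables false

noncomputable section

universe u

/-- A type is contractible if it is inhabited and all its inhabitants are equal. -/
def IsContr (X : Type u) : Prop := Nonempty X ∧ ∀ a b : X, a = b

/-- A type is a proposition ((-1)-type) if all its inhabitants are equal. -/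
def IsProp (X : Type u) : Prop := ∀ a b : X, a = b

/-- A type is a set (0-type) if any two parallel equality proofs are equal. -/
def IsSet (X : Type u) : Prop := ∀ (a b : X) (p q : a = b), p = q

/-- A type is a 1-type if its equality types are sets. -/
def IsOneType (X : Type u) : Prop := ∀ (a b : X) (p q : a = b) (r s : p = q), r = s

/-- A `Type u`-valued version of the equality type (for use as a family of fillers). -/
def EqU.{w, v} {X : Sort v} (a b : X) : Type w := ULift.{w} (PLift (a = b))

def EqU.mk.{w, v} {X : Sort v} {a b : X} (p : a = b) : EqU.{w} a b := ⟨⟨p⟩⟩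

def EqU.out.{w, v} {X : Sort v} {a b : X} (e : EqU.{w} a b) : a = b := e.down.down

/-! ### Categorical structures -/

/-- A graph with a composition operator: a transitive graph. -/
structure TransGraph : Type (u + 1) where
  Ob : Type u
  Hom : Ob → Ob → Type u
  comp : ∀ {a b c : Ob}, Hom b c → Hom a b → Hom a c

/-- A transitive graph with identities: a reflexive-transitive graph. -/
structure ReflTransGraph extends TransGraph where
  Id : ∀ x : Ob, Hom x x

/-- A wild semicategory: a transitive graph with an associator
`α(f,g,h) : h ∘ (g ∘ f) = (h ∘ g) ∘ f`. -/
structure WildSemicat extends TransGraph where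
  assoc : ∀ {a b c d : Ob} (f : Hom a b) (g : Hom b c) (h : Hom c d),
    comp h (comp g f) = comp (comp h g) f

/-- A wild 2-semicategory: a wild semicategory with a pentagonator.
(The two sides are the two composite paths around Mac Lane's pentagon
`k∘(h∘(g∘f)) = ((k∘h)∘g)∘f`.) -/
structure WildSemicat2 extends WildSemicat where
  pentagon : ∀ {a b c d e : Ob} (f : Hom a b) (g : Hom b c) (h : Hom c d) (k : Hom d e),
    (congrArg (fun z => comp k z) (assoc f g h)).trans
        ((assoc f (comp h g) k).trans (congrArg (fun z => comp z f) (assoc g h k))) =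
      (assoc (comp g f) h k).trans (assoc f g (comp k h))

/-- A wild precategory: a wild semicategory with identities and unitors. -/
structure WildPrecat extends WildSemicat where
  Id : ∀ x : Ob, Hom x x
  lunit : ∀ {x y : Ob} (f : Hom x y), comp (Id y) f = f
  runit : ∀ {x y : Ob} (f : Hom x y), comp f (Id x) = f

/-- A wild 2-precategory: a wild 2-semicategory with identities, unitors, and the
three triangle coherences `t₁`, `t₀`, `t₂`. -/
structure Wild2Precat extends WildSemicat2 where
  Id : ∀ x : Ob, Hom x x
  lunit : ∀ {x y : Ob} (f : Hom x y), comp (Id y) f = f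
  runit : ∀ {x y : Ob} (f : Hom x y), comp f (Id x) = f
  t1 : ∀ {x y z : Ob} (f : Hom x y) (g : Hom y z),
    congrArg (fun v => comp g v) (lunit f) =
      (assoc f (Id y) g).trans (congrArg (fun v => comp v f) (runit g))
  t0 : ∀ {x y z : Ob} (f : Hom x y) (g : Hom y z),
    lunit (comp g f) = (assoc f g (Id z)).trans (congrArg (fun v => comp v f) (lunit g))
  t2 : ∀ {x y z : Ob} (f : Hom x y) (g : Hom y z),
    congrArg (fun v => comp g v) (runit f) = (assoc (Id x) f g).trans (runit (comp g f))

def Wild2Precat.toWildPrecat (C : Wild2Precat.{u}) : WildPrecat.{u} where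
  toWildSemicat := C.toWildSemicat2.toWildSemicat
  Id := C.Id
  lunit := C.lunit
  runit := C.runit

/-! ### Restricted semisimplicial types -/

/-- A 2-restricted semisimplicial type: points, edges, triangle fillers. -/
structure SST2 : Type (u + 1) where
  A0 : Type u
  A1 : A0 → A0 → Type u
  A2 : ∀ {x0 x1 x2 : A0}, A1 x0 x1 → A1 x1 x2 → A1 x0 x2 → Type u

/-- A 3-restricted semisimplicial type: additionally, tetrahedron fillers. -/
structure SST3 extends SST2 where
  A3 : ∀ {x0 x1 x2 x3 : A0}
      {x01 : A1 x0 x1} {x12 : A1 x1 x2} {x23 : A1 x2 x3}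
      {x02 : A1 x0 x2} {x13 : A1 x1 x3} {x03 : A1 x0 x3},
    A2 x01 x12 x02 → A2 x01 x13 x03 → A2 x02 x23 x03 → A2 x12 x23 x13 → Type u

/-- A 4-restricted semisimplicial type: additionally, 4-cell fillers. -/
structure SST4 extends SST3 where
  A4 : ∀ {x0 x1 x2 x3 x4 : A0}
      {x01 : A1 x0 x1} {x12 : A1 x1 x2} {x23 : A1 x2 x3} {x34 : A1 x3 x4}
      {x02 : A1 x0 x2} {x13 : A1 x1 x3} {x24 : A1 x2 x4}
      {x03 : A1 x0 x3} {x14 : A1 x1 x4} {x04 : A1 x0 x4}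
      {x012 : A2 x01 x12 x02} {x013 : A2 x01 x13 x03} {x014 : A2 x01 x14 x04}
      {x023 : A2 x02 x23 x03} {x024 : A2 x02 x24 x04} {x034 : A2 x03 x34 x04}
      {x123 : A2 x12 x23 x13} {x124 : A2 x12 x24 x14} {x134 : A2 x13 x34 x14}
      {x234 : A2 x23 x34 x24},
    A3 x012 x013 x023 x123 → A3 x012 x014 x024 x124 → A3 x013 x014 x034 x134 →
      A3 x023 x024 x034 x234 → A3 x123 x124 x134 x234 → Type u

/-- Contractible `(2,1)`-horn filling: every `Λ²₁`-horn (a pair of composable edges)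
has a contractible type of fillers (missing edge together with a triangle filler). -/
def SST2.Horn21Contr (S : SST2.{u}) : Prop :=
  ∀ {x0 x1 x2 : S.A0} (x01 : S.A1 x0 x1) (x12 : S.A1 x1 x2),
    IsContr ((x02 : S.A1 x0 x2) × S.A2 x01 x12 x02)

/-- Contractible `(3,1)`-horn filling: every `Λ³₁`-horn has a contractible type of
fillers (missing face `x023` together with a tetrahedron filler). -/
def SST3.Horn31Contr (S : SST3.{u}) : Prop :=
  ∀ {x0 x1 x2 x3 : S.A0}
    {x01 : S.A1 x0 x1} {x12 : S.A1 x1 x2} {x23 : S.A1 x2 x3}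
    {x02 : S.A1 x0 x2} {x13 : S.A1 x1 x3} {x03 : S.A1 x0 x3}
    (x012 : S.A2 x01 x12 x02) (x013 : S.A2 x01 x13 x03) (x123 : S.A2 x12 x23 x13),
    IsContr ((x023 : S.A2 x02 x23 x03) × S.A3 x012 x013 x023 x123)

/-- Contractible `(4,1)`-horn filling: every `Λ⁴₁`-horn has a contractible type of
fillers (missing face `x0234` together with a 4-cell filler). -/
def SST4.Horn41Contr (S : SST4.{u}) : Prop :=
  ∀ {x0 x1 x2 x3 x4 : S.A0}
    {x01 : S.A1 x0 x1} {x12 : S.A1 x1 x2} {x23 : S.A1 x2 x3} {x34 : S.A1 x3 x4}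
    {x02 : S.A1 x0 x2} {x13 : S.A1 x1 x3} {x24 : S.A1 x2 x4}
    {x03 : S.A1 x0 x3} {x14 : S.A1 x1 x4} {x04 : S.A1 x0 x4}
    {x012 : S.A2 x01 x12 x02} {x013 : S.A2 x01 x13 x03} {x014 : S.A2 x01 x14 x04}
    {x023 : S.A2 x02 x23 x03} {x024 : S.A2 x02 x24 x04} {x034 : S.A2 x03 x34 x04}
    {x123 : S.A2 x12 x23 x13} {x124 : S.A2 x12 x24 x14} {x134 : S.A2 x13 x34 x14}
    {x234 : S.A2 x23 x34 x24}
    (x0123 : S.A3 x012 x013 x023 x123) (x0124 : S.A3 x012 x014 x024 x124)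
    (x0134 : S.A3 x013 x014 x034 x134) (x1234 : S.A3 x123 x124 x134 x234),
    IsContr ((x0234 : S.A3 x023 x024 x034 x234) × S.A4 x0123 x0124 x0134 x0234 x1234)

/-- A 2-restricted semi-Segal type. -/
structure SegalSST2 extends SST2 where
  h2 : SST2.Horn21Contr toSST2

/-- A 3-restricted semi-Segal type. -/
structure SegalSST3 extends SST3 where
  h2 : SST2.Horn21Contr toSST3.toSST2
  h3 : SST3.Horn31Contr toSST3

/-- A 4-restricted semi-Segal type. -/
structure SegalSST4 extends SST4 where
  h2 : SST2.Horn21Contr toSST4.toSST3.toSST2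
  h3 : SST3.Horn31Contr toSST4.toSST3
  h4 : SST4.Horn41Contr toSST4

/-- A 2-restricted semi-Segal type with degeneracies (a 1-degeneracy structure). -/
structure DegSST2 extends SegalSST2 where
  s00 : ∀ x : A0, A1 x x

/-- A 3-restricted semi-Segal type with degeneracies (a 2-degeneracy structure). -/
structure DegSST3 extends SegalSST3 where
  s00 : ∀ x : A0, A1 x x
  s10 : ∀ {x0 x1 : A0} (x01 : A1 x0 x1), A2 (s00 x0) x01 x01
  s11 : ∀ {x0 x1 : A0} (x01 : A1 x0 x1), A2 x01 (s00 x1) x01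

/-- A 4-restricted semi-Segal type with degeneracies (a 3-degeneracy structure). -/
structure DegSST4 extends SegalSST4 where
  s00 : ∀ x : A0, A1 x x
  s10 : ∀ {x0 x1 : A0} (x01 : A1 x0 x1), A2 (s00 x0) x01 x01
  s11 : ∀ {x0 x1 : A0} (x01 : A1 x0 x1), A2 x01 (s00 x1) x01
  s20 : ∀ {x0 x1 x2 : A0} {x01 : A1 x0 x1} {x12 : A1 x1 x2} {x02 : A1 x0 x2}
      (x012 : A2 x01 x12 x02), A3 (s10 x01) (s10 x02) x012 x012
  s21 : ∀ {x0 x1 x2 : A0} {x01 : A1 x0 x1} {x12 : A1 x1 x2} {x02 : A1 x0 x2}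
      (x012 : A2 x01 x12 x02), A3 (s11 x01) x012 x012 (s10 x12)
  s22 : ∀ {x0 x1 x2 : A0} {x01 : A1 x0 x1} {x12 : A1 x1 x2} {x02 : A1 x0 x2}
      (x012 : A2 x01 x12 x02), A3 x012 x012 (s11 x02) (s11 x12)

def DegSST3.toDegSST2 (S : DegSST3.{u}) : DegSST2.{u} where
  toSegalSST2 := { toSST2 := S.toSegalSST3.toSST3.toSST2, h2 := S.h2 }
  s00 := S.s00

def DegSST4.toDegSST3 (S : DegSST4.{u}) : DegSST3.{u} where
  toSegalSST3 := { toSST3 := S.toSegalSST4.toSST4.toSST3, h2 := S.h2, h3 := S.h3 }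
  s00 := S.s00
  s10 := S.s10
  s11 := S.s11

/-! ### Neutral edges and completeness -/

/-- An edge `e` of a (2-restricted) semisimplicial type is right-neutral if every
`Λ²₀`-horn with critical edge `e` has contractible filling. -/
def SST2.RightNeutralE (S : SST2.{u}) {a b : S.A0} (e : S.A1 a b) : Prop :=
  ∀ (z : S.A0) (h : S.A1 a z), IsContr ((g : S.A1 b z) × S.A2 e g h)

/-- An edge `e` is left-neutral if every `Λ²₂`-horn with critical edge `e` has
contractible filling. -/
def SST2.LeftNeutralE (S : SST2.{u}) {a b : S.A0} (e : S.A1 a b) : Prop :=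
  ∀ (w : S.A0) (h : S.A1 w b), IsContr ((g : S.A1 w a) × S.A2 g e h)

/-- A neutral edge: both right- and left-neutral. -/
def SST2.NeutralE (S : SST2.{u}) {a b : S.A0} (e : S.A1 a b) : Prop :=
  S.RightNeutralE e ∧ S.LeftNeutralE e

/-- Completeness: for every point `x` there is a unique neutral edge with codomain `x`. -/
def SST2.Complete (S : SST2.{u}) : Prop :=
  ∀ x : S.A0, IsContr ((y : S.A0) × { e : S.A1 y x // S.NeutralE e })

/-- A morphism `f` of a transitive graph (regarded as a 2-restricted semisimplicial
type whose triangle fillers are `x₁₂ ∘ x₀₁ = x₀₂`) is right-neutral if every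
`Λ²₀`-horn with critical edge `f` has contractible filling. -/
def TransGraph.RightNeutral (G : TransGraph.{u}) {x y : G.Ob} (f : G.Hom x y) : Prop :=
  ∀ (z : G.Ob) (h : G.Hom x z), IsContr { g : G.Hom y z // G.comp g f = h }

/-- Left-neutral morphism of a transitive graph. -/
def TransGraph.LeftNeutral (G : TransGraph.{u}) {x y : G.Ob} (f : G.Hom x y) : Prop :=
  ∀ (w : G.Ob) (h : G.Hom w y), IsContr { g : G.Hom w x // G.comp f g = h }

/-! ### The categorical structure induced by a semi-Segal type with degeneracies -/

/-- The composite `g ∘ f` obtained from contractible `(2,1)`-horn filling. -/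
def DegSST2.ecomp (S : DegSST2.{u}) {x y z : S.A0} (g : S.A1 y z) (f : S.A1 x y) :
    S.A1 x z :=
  (Classical.choice (S.h2 f g).1).1

def DegSST2.ecompWitness (S : DegSST2.{u}) {x y z : S.A0} (g : S.A1 y z) (f : S.A1 x y) :
    S.A2 f g (S.ecomp g f) :=
  (Classical.choice (S.h2 f g).1).2

theorem DegSST2.ecomp_eq (S : DegSST2.{u}) {x y z : S.A0} (f : S.A1 x y) (g : S.A1 y z)
    {h : S.A1 x z} (t : S.A2 f g h) : S.ecomp g f = h :=
  congrArg Sigma.fst ((S.h2 f g).2 ⟨S.ecomp g f, S.ecompWitness g f⟩ ⟨h, t⟩)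

/-- The reflexive-transitive graph induced by a 2-restricted semi-Segal type with
degeneracies: composition from horn filling, identities from the degeneracies. -/
def DegSST2.toRTG (S : DegSST2.{u}) : ReflTransGraph.{u} where
  Ob := S.A0
  Hom := S.A1
  comp := fun g f => S.ecomp g f
  Id := S.s00

/-! ### Isomorphisms and univalence -/

/-- The type of isomorphism witnesses of `f`: a left inverse together with
a right inverse. -/
abbrev IsoWitness (G : ReflTransGraph.{u}) {x y : G.Ob} (f : G.Hom x y) : Type u :=
  ({ g : G.Hom y x // G.comp g f = G.Id x }) × ({ g : G.Hom y x // G.comp f g = G.Id y })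

/-- The canonical map `idtoiso`, sending `refl` to the identity with a chosen
isomorphism witness. -/
def idtoiso (G : ReflTransGraph.{u}) (w : ∀ x : G.Ob, IsoWitness G (G.Id x))
    {x y : G.Ob} : x = y → (f : G.Hom x y) × IsoWitness G f
  | rfl => ⟨G.Id x, w x⟩

/-- Univalence: `idtoiso` is an equivalence (bijective) for all pairs of objects. -/
def UnivalentRTG (G : ReflTransGraph.{u}) (w : ∀ x : G.Ob, IsoWitness G (G.Id x)) : Prop :=
  ∀ x y : G.Ob, Function.Bijective (fun p : x = y => idtoiso G w p)

/-- If all hom-types are propositions, every identity is an isomorphism. -/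
def idIsoOfProp (G : ReflTransGraph.{u}) (h : ∀ (x y : G.Ob), IsProp (G.Hom x y))
    (x : G.Ob) : IsoWitness G (G.Id x) :=
  ⟨⟨G.Id x, h x x _ _⟩, ⟨G.Id x, h x x _ _⟩⟩

def WildPrecat.toRTG (C : WildPrecat.{u}) : ReflTransGraph.{u} where
  toTransGraph := C.toWildSemicat.toTransGraph
  Id := C.Id

/-- In a wild precategory, every identity is an isomorphism (via the unitors). -/
def WildPrecat.idIso (C : WildPrecat.{u}) (x : C.Ob) :
    IsoWitness C.toRTG (C.toRTG.Id x) :=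
  ⟨⟨C.Id x, C.lunit (C.Id x)⟩, ⟨C.Id x, C.lunit (C.Id x)⟩⟩

/-- In a 3-restricted semi-Segal type with degeneracies, every degenerate edge is an
isomorphism of the induced reflexive-transitive graph. -/
def DegSST3.idIso (S : DegSST3.{u}) (x : S.A0) :
    IsoWitness S.toDegSST2.toRTG (S.toDegSST2.toRTG.Id x) :=
  ⟨⟨S.s00 x, DegSST2.ecomp_eq S.toDegSST2 (S.s00 x) (S.s00 x) (S.s10 (S.s00 x))⟩,
   ⟨S.s00 x, DegSST2.ecomp_eq S.toDegSST2 (S.s00 x) (S.s00 x) (S.s10 (S.s00 x))⟩⟩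

/-! ### Specific semisimplicial types built from categorical data -/

/-- The 2-restricted semisimplicial type associated with a transitive graph:
triangle fillers are equalities `x₁₂ ∘ x₀₁ = x₀₂`. -/
def TransGraph.toSST2 (G : TransGraph.{u}) : SST2.{u} where
  A0 := G.Ob
  A1 := G.Hom
  A2 := fun x01 x12 x02 => EqU.{u} (G.comp x12 x01) x02

/-- The generalised associator `α̂` of a wild semicategory. -/
def WildSemicat.genAssoc (C : WildSemicat.{u}) {x0 x1 x2 x3 : C.Ob}
    {x01 : C.Hom x0 x1} {x12 : C.Hom x1 x2} {x23 : C.Hom x2 x3}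
    {x02 : C.Hom x0 x2} {x13 : C.Hom x1 x3} {x03 : C.Hom x0 x3}
    (x012 : C.comp x12 x01 = x02) (x013 : C.comp x13 x01 = x03)
    (x123 : C.comp x23 x12 = x13) : C.comp x23 x02 = x03 :=
  (congrArg (fun e => C.comp x23 e) x012.symm).trans
    ((C.assoc x01 x12 x23).trans ((congrArg (fun e => C.comp e x01) x123).trans x013))

/-- The 3-restricted semisimplicial type associated with a wild semicategory:
tetrahedron fillers are equalities `α̂(u) = x₀₂₃`. -/
def WildSemicat.toSST3 (C : WildSemicat.{u}) : SST3.{u} where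
  toSST2 := C.toTransGraph.toSST2
  A3 := fun x012 x013 x023 x123 =>
    EqU.{u} (C.genAssoc (EqU.out x012) (EqU.out x013) (EqU.out x123)) (EqU.out x023)

/-! ### Horns and spines -/

/-- The type of `Λ³₁`-horns. -/
abbrev SST3.Horn31T (S : SST3.{u}) : Type u :=
  (x0 : S.A0) × (x1 : S.A0) × (x2 : S.A0) × (x3 : S.A0) ×
  (x01 : S.A1 x0 x1) × (x12 : S.A1 x1 x2) × (x23 : S.A1 x2 x3) ×
  (x02 : S.A1 x0 x2) × (x13 : S.A1 x1 x3) × (x03 : S.A1 x0 x3) ×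
  (x012 : S.A2 x01 x12 x02) × (x013 : S.A2 x01 x13 x03) × S.A2 x12 x23 x13

/-- The type of 3-spines. -/
abbrev SST3.Spine3T (S : SST3.{u}) : Type u :=
  (x0 : S.A0) × (x1 : S.A0) × (x2 : S.A0) × (x3 : S.A0) ×
  (x01 : S.A1 x0 x1) × (x12 : S.A1 x1 x2) × S.A1 x2 x3

/-- The canonical projection from `Λ³₁`-horns to 3-spines. -/
def SST3.phi3 (S : SST3.{u}) : S.Horn31T → S.Spine3T :=
  fun ⟨x0, x1, x2, x3, x01, x12, x23, _⟩ => ⟨x0, x1, x2, x3, x01, x12, x23⟩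

/-- The type of `Λ⁴₁`-horns. -/
abbrev SST4.Horn41T (S : SST4.{u}) :=
  (x0 : S.A0) × (x1 : S.A0) × (x2 : S.A0) × (x3 : S.A0) × (x4 : S.A0) ×
  (x01 : S.A1 x0 x1) × (x12 : S.A1 x1 x2) × (x23 : S.A1 x2 x3) × (x34 : S.A1 x3 x4) ×
  (x02 : S.A1 x0 x2) × (x13 : S.A1 x1 x3) × (x24 : S.A1 x2 x4) ×
  (x03 : S.A1 x0 x3) × (x14 : S.A1 x1 x4) × (x04 : S.A1 x0 x4) ×
  (x012 : S.A2 x01 x12 x02) × (x013 : S.A2 x01 x13 x03) × (x014 : S.A2 x01 x14 x04) ×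
  (x023 : S.A2 x02 x23 x03) × (x024 : S.A2 x02 x24 x04) × (x034 : S.A2 x03 x34 x04) ×
  (x123 : S.A2 x12 x23 x13) × (x124 : S.A2 x12 x24 x14) × (x134 : S.A2 x13 x34 x14) ×
  (x234 : S.A2 x23 x34 x24) ×
  (x0123 : S.A3 x012 x013 x023 x123) × (x0124 : S.A3 x012 x014 x024 x124) ×
  (x0134 : S.A3 x013 x014 x034 x134) × S.A3 x123 x124 x134 x234

/-- The type of 4-spines. -/
abbrev SST4.Spine4T (S : SST4.{u}) : Type u :=
  (x0 : S.A0) × (x1 : S.A0) × (x2 : S.A0) × (x3 : S.A0) × (x4 : S.A0) ×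
  (x01 : S.A1 x0 x1) × (x12 : S.A1 x1 x2) × (x23 : S.A1 x2 x3) × S.A1 x3 x4

/-- The canonical projection from `Λ⁴₁`-horns to 4-spines. -/
def SST4.phi4 (S : SST4.{u}) : S.Horn41T → S.Spine4T :=
  fun ⟨x0, x1, x2, x3, x4, x01, x12, x23, x34, _⟩ =>
    ⟨x0, x1, x2, x3, x4, x01, x12, x23, x34⟩

/-! ### Degeneracy structures as types -/

/-- The type of 1-degeneracy structures. -/
abbrev SST2.Deg1 (S : SST2.{u}) : Type u := ∀ x : S.A0, S.A1 x x

/-- The type of 2-degeneracy structures. -/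
abbrev SST2.Deg2 (S : SST2.{u}) : Type u :=
  (s00 : S.Deg1) ×
    ((∀ (x0 x1 : S.A0) (x01 : S.A1 x0 x1), S.A2 (s00 x0) x01 x01) ×
     (∀ (x0 x1 : S.A0) (x01 : S.A1 x0 x1), S.A2 x01 (s00 x1) x01))

/-- The type of 3-degeneracy structures. -/
abbrev SST3.Deg3 (S : SST3.{u}) : Type u :=
  (d : SST2.Deg2 S.toSST2) ×
    ((∀ (x0 x1 x2 : S.A0) (x01 : S.A1 x0 x1) (x12 : S.A1 x1 x2) (x02 : S.A1 x0 x2)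
        (x012 : S.A2 x01 x12 x02), S.A3 (d.2.1 x0 x1 x01) (d.2.1 x0 x2 x02) x012 x012) ×
     (∀ (x0 x1 x2 : S.A0) (x01 : S.A1 x0 x1) (x12 : S.A1 x1 x2) (x02 : S.A1 x0 x2)
        (x012 : S.A2 x01 x12 x02), S.A3 (d.2.2 x0 x1 x01) x012 x012 (d.2.1 x1 x2 x12)) ×
     (∀ (x0 x1 x2 : S.A0) (x01 : S.A1 x0 x1) (x12 : S.A1 x1 x2) (x02 : S.A1 x0 x2)
        (x012 : S.A2 x01 x12 x02), S.A3 x012 x012 (d.2.2 x0 x2 x02) (d.2.2 x1 x2 x12)))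

/-! ### Extension structures -/

/-- The structure needed to extend a wild semicategory to a precategory. -/
structure PrecatExt (C : WildSemicat.{u}) : Type u where
  Id : ∀ x : C.Ob, C.Hom x x
  lunit : ∀ {x y : C.Ob} (f : C.Hom x y), C.comp (Id y) f = f
  runit : ∀ {x y : C.Ob} (f : C.Hom x y), C.comp f (Id x) = f
  hset : ∀ (x y : C.Ob), IsSet (C.Hom x y)

/-- The structure needed to extend a wild 2-semicategory to a 2-precategory. -/
structure TwoPrecatExt (C : WildSemicat2.{u}) : Type u where
  Id : ∀ x : C.Ob, C.Hom x x
  lunit : ∀ {x y : C.Ob} (f : C.Hom x y), C.comp (Id y) f = f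
  runit : ∀ {x y : C.Ob} (f : C.Hom x y), C.comp f (Id x) = f
  t1 : ∀ {x y z : C.Ob} (f : C.Hom x y) (g : C.Hom y z),
    congrArg (fun v => C.comp g v) (lunit f) =
      (C.assoc f (Id y) g).trans (congrArg (fun v => C.comp v f) (runit g))
  t0 : ∀ {x y z : C.Ob} (f : C.Hom x y) (g : C.Hom y z),
    lunit (C.comp g f) =
      (C.assoc f g (Id z)).trans (congrArg (fun v => C.comp v f) (lunit g))
  t2 : ∀ {x y z : C.Ob} (f : C.Hom x y) (g : C.Hom y z),
    congrArg (fun v => C.comp g v) (runit f) =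
      (C.assoc (Id x) f g).trans (runit (C.comp g f))
  h1 : ∀ (x y : C.Ob), IsOneType (C.Hom x y)

/-! ### Well-behaved categorical structures -/

/-- A poset (univalent 0-category). -/
structure Poset extends ReflTransGraph where
  hprop : ∀ (x y : Ob), IsProp (Hom x y)
  univ : UnivalentRTG toReflTransGraph (idIsoOfProp toReflTransGraph hprop)

/-- A univalent category. -/
structure UnivCat extends WildPrecat where
  hset : ∀ (x y : Ob), IsSet (Hom x y)
  univ : UnivalentRTG (WildPrecat.toRTG toWildPrecat) (WildPrecat.idIso toWildPrecat)

/-- A univalent 2-category. -/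
structure Univ2Cat extends Wild2Precat where
  h1 : ∀ (x y : Ob), IsOneType (Hom x y)
  univ : UnivalentRTG (WildPrecat.toRTG (Wild2Precat.toWildPrecat toWild2Precat))
    (WildPrecat.idIso (Wild2Precat.toWildPrecat toWild2Precat))

/-- A univalent semi-Segal set. -/
structure USSSet extends DegSST2 where
  hprop : ∀ (x y : A0), IsProp (A1 x y)
  univ : UnivalentRTG toDegSST2.toRTG (idIsoOfProp toDegSST2.toRTG hprop)

/-- A univalent semi-Segal 1-type. -/
structure USS1 extends DegSST3 where
  hset : ∀ (x y : A0), IsSet (A1 x y)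
  univ : UnivalentRTG toDegSST3.toDegSST2.toRTG (DegSST3.idIso toDegSST3)

/-- A univalent semi-Segal 2-type. -/
structure USS2 extends DegSST4 where
  h1 : ∀ (x y : A0), IsOneType (A1 x y)
  univ : UnivalentRTG toDegSST4.toDegSST3.toDegSST2.toRTG
    (DegSST3.idIso toDegSST4.toDegSST3)

/-! ### Complete semi-Segal n-types -/

/-- A complete semi-Segal 0-type. -/
structure CSS0 extends SST2 where
  h2 : SST2.Horn21Contr toSST2
  complete : SST2.Complete toSST2
  htrunc : ∀ (x y : A0), IsProp (A1 x y)

/-- A complete semi-Segal 1-type. -/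
structure CSS1 extends SST3 where
  h2 : SST2.Horn21Contr toSST3.toSST2
  h3 : SST3.Horn31Contr toSST3
  complete : SST2.Complete toSST3.toSST2
  htrunc : ∀ (x y : A0), IsSet (A1 x y)

/-- A complete semi-Segal 2-type. -/
structure CSS2 extends SST4 where
  h2 : SST2.Horn21Contr toSST4.toSST3.toSST2
  h3 : SST3.Horn31Contr toSST4.toSST3
  h4 : SST4.Horn41Contr toSST4
  complete : SST2.Complete toSST4.toSST3.toSST2
  htrunc : ∀ (x y : A0), IsOneType (A1 x y)

/-- For any 3-restricted semi-Segal type, the canonical projection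
`φ₃ : Λ³₁ → Sp³` is an equivalence. -/
theorem stmt_4 (S : SST3.{u}) (h2 : SST2.Horn21Contr S.toSST2) (h3 : S.Horn31Contr) :
    Function.Bijective S.phi3 := by
  constructor
  · rintro ⟨x0, x1, x2, x3, x01, x12, x23, x02, x13, x03, x012, x013, x123⟩
      ⟨y0, y1, y2, y3, y01, y12, y23, y02, y13, y03, y012, y013, y123⟩ h
    change (⟨x0, x1, x2, x3, x01, x12, x23⟩ : S.Spine3T) =
      ⟨y0, y1, y2, y3, y01, y12, y23⟩ at h
    cases h
    cases (h2 x01 x12).2 ⟨x02, x012⟩ ⟨y02, y012⟩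
    cases (h2 x12 x23).2 ⟨x13, x123⟩ ⟨y13, y123⟩
    cases (h2 x01 x13).2 ⟨x03, x013⟩ ⟨y03, y013⟩
    rfl
  · rintro ⟨x0, x1, x2, x3, x01, x12, x23⟩
    obtain ⟨x02, x012⟩ := (h2 x01 x12).1
    obtain ⟨x13, x123⟩ := (h2 x12 x23).1
    obtain ⟨x03, x013⟩ := (h2 x01 x13).1
    exact ⟨⟨x0, x1, x2, x3, x01, x12, x23, x02, x13, x03, x012, x013, x123⟩, rfl⟩
end
end

section
/- For any 4-restricted semi-Segal type, the canonical projection φ₄ : Λ⁴₁ → Sp⁴ from the type of Λ⁴₁-horns to the type of 4-spines, which discards all components except the five points and the four consecutive edges x₀₁, x₁₂, x₂₃, x₃₄, is an equivalence of types. -/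
set_option autoImplicit false
set_option linter.unusedVariables false

noncomputable section

universe u

/-- For any 4-restricted semi-Segal type, the canonical projection
`φ₄ : Λ⁴₁ → Sp⁴` is an equivalence. -/
theorem stmt_5 (S : SST4.{u}) (h2 : SST2.Horn21Contr S.toSST3.toSST2)
    (h3 : SST3.Horn31Contr S.toSST3) (h4 : S.Horn41Contr) :
    Function.Bijective S.phi4 := by
  constructor
  · rintro ⟨x0, x1, x2, x3, x4, x01, x12, x23, x34,
      x02, x13, x24, x03, x14, x04, x012, x013, x014, x023,
      x024, x034, x123, x124, x134, x234, x0123, x0124, x0134, x1234⟩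
      ⟨y0, y1, y2, y3, y4, y01, y12, y23, y34,
      y02, y13, y24, y03, y14, y04, y012, y013, y014, y023,
      y024, y034, y123, y124, y134, y234, y0123, y0124, y0134, y1234⟩ h
    cases h
    cases (h2 x01 x12).2 ⟨x02, x012⟩ ⟨y02, y012⟩
    cases (h2 x12 x23).2 ⟨x13, x123⟩ ⟨y13, y123⟩
    cases (h2 x23 x34).2 ⟨x24, x234⟩ ⟨y24, y234⟩
    cases (h2 x01 x13).2 ⟨x03, x013⟩ ⟨y03, y013⟩
    cases (h3 x012 x013 x123).2 ⟨x023, x0123⟩ ⟨y023, y0123⟩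
    cases (h2 x12 x24).2 ⟨x14, x124⟩ ⟨y14, y124⟩
    cases (h3 x123 x124 x234).2 ⟨x134, x1234⟩ ⟨y134, y1234⟩
    cases (h2 x01 x14).2 ⟨x04, x014⟩ ⟨y04, y014⟩
    cases (h3 x012 x014 x124).2 ⟨x024, x0124⟩ ⟨y024, y0124⟩
    cases (h3 x013 x014 x134).2 ⟨x034, x0134⟩ ⟨y034, y0134⟩
    rfl
  · rintro ⟨x0, x1, x2, x3, x4, x01, x12, x23, x34⟩
    obtain ⟨x02, x012⟩ := (h2 x01 x12).1
    obtain ⟨x13, x123⟩ := (h2 x12 x23).1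
    obtain ⟨x24, x234⟩ := (h2 x23 x34).1
    obtain ⟨x03, x013⟩ := (h2 x01 x13).1
    obtain ⟨x023, x0123⟩ := (h3 x012 x013 x123).1
    obtain ⟨x14, x124⟩ := (h2 x12 x24).1
    obtain ⟨x134, x1234⟩ := (h3 x123 x124 x234).1
    obtain ⟨x04, x014⟩ := (h2 x01 x14).1
    obtain ⟨x024, x0124⟩ := (h3 x012 x014 x124).1
    obtain ⟨x034, x0134⟩ := (h3 x013 x014 x134).1
    exact ⟨⟨x0, x1, x2, x3, x4, x01, x12, x23, x34,
      x02, x13, x24, x03, x14, x04, x012, x013, x014, x023,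
      x024, x034, x123, x124, x134, x234, x0123, x0124, x0134, x1234⟩, rfl⟩
end
end

section
/- If a 3-restricted semisimplicial type has contractible (2,1)-horn filling and contractible (3,1)-horn filling, then it also has contractible (3,2)-horn filling: for every Λ³₂-horn x, the type of pairs (x₀₁₃, x₀₁₂₃) consisting of the missing triangle filler x₀₁₃ and a tetrahedron filler x₀₁₂₃ for the completed boundary is contractible. -/
set_option autoImplicit false
set_option linter.unusedVariables false

noncomputable section

universe u

/-- If a 3-restricted semisimplicial type has contractible `(2,1)`- and
`(3,1)`-horn filling, then it has contractible `(3,2)`-horn filling. -/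
theorem stmt_6 (S : SST3.{u}) (h2 : SST2.Horn21Contr S.toSST2) (h3 : S.Horn31Contr)
    {x0 x1 x2 x3 : S.A0}
    {x01 : S.A1 x0 x1} {x12 : S.A1 x1 x2} {x23 : S.A1 x2 x3}
    {x02 : S.A1 x0 x2} {x13 : S.A1 x1 x3} {x03 : S.A1 x0 x3}
    (x012 : S.A2 x01 x12 x02) (x023 : S.A2 x02 x23 x03) (x123 : S.A2 x12 x23 x13) :
    IsContr ((x013 : S.A2 x01 x13 x03) × S.A3 x012 x013 x023 x123) := by
  constructor
  · obtain ⟨y03, y013⟩ := Classical.choice (h2 x01 x13).1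
    obtain ⟨y023, y0123⟩ := Classical.choice (h3 x012 y013 x123).1
    cases (h2 x02 x23).2 ⟨y03, y023⟩ ⟨x03, x023⟩
    exact ⟨⟨y013, y0123⟩⟩
  · rintro ⟨a013, a0123⟩ ⟨b013, b0123⟩
    cases (h2 x01 x13).2 ⟨x03, a013⟩ ⟨x03, b013⟩
    cases (h3 x012 a013 x123).2 ⟨x023, a0123⟩ ⟨x023, b0123⟩
    rfl
end
end

section
/- Let (Ob, Hom, ∘, α) be a wild semicategory. Then the type of structures extending it to a precategory is a proposition: the type of tuples (Id, λ, ρ, h), where Id : ∀ x, Hom(x,x), λ : ∀ f, Id ∘ f = f, ρ : ∀ f, f ∘ Id = f, and h witnesses that each Hom(x,y) is a set, has all its inhabitants equal. -/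
set_option autoImplicit false
set_option linter.unusedVariables false

noncomputable section

universe u

/-- The type of structures extending a wild semicategory to a precategory is a
proposition. -/
theorem stmt_10 (C : WildSemicat.{u}) (a b : PrecatExt C) : a = b := by
  obtain ⟨I, l, r, h⟩ := a
  obtain ⟨J, l', r', h'⟩ := b
  obtain rfl : I = J := funext fun x => (r' (I x)).symm.trans (l (J x))
  rfl
end
end

section
/- Let C be a wild precategory. For every morphism f : Hom(x,y), the type isNeutral(f) (f is both left-neutral and right-neutral) is equivalent to the type isIso(f) (f has both a left inverse and a right inverse). In particular, isIso(f) is a proposition. -/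
set_option autoImplicit false
set_option linter.unusedVariables false

noncomputable section

universe u

namespace WildPrecat

variable {C : WildPrecat.{u}} {x y : C.Ob} {f : C.Hom x y}

/-- Precomposition with a morphism that has both inverses is bijective. -/
theorem rightNeutral_of_inverses {l r : C.Hom y x} (hl : C.comp l f = C.Id x)
    (hr : C.comp f r = C.Id y) : TransGraph.RightNeutral C.toWildSemicat.toTransGraph f := by
  intro z h
  refine ⟨⟨C.comp h l, by rw [← C.assoc, hl, C.runit]⟩, ?_⟩
  have cancel (g : C.Hom y z) (hg : C.comp g f = h) : g = C.comp h r := by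
    rw [← hg, ← C.assoc, hr, C.runit]
  rintro ⟨g, hg⟩ ⟨g', hg'⟩
  exact Subtype.ext ((cancel g hg).trans (cancel g' hg').symm)

/-- Postcomposition with a morphism that has both inverses is bijective. -/
theorem leftNeutral_of_inverses {l r : C.Hom y x} (hl : C.comp l f = C.Id x)
    (hr : C.comp f r = C.Id y) : TransGraph.LeftNeutral C.toWildSemicat.toTransGraph f := by
  intro w h
  refine ⟨⟨C.comp r h, by rw [C.assoc, hr, C.lunit]⟩, ?_⟩
  have cancel (g : C.Hom w x) (hg : C.comp f g = h) : g = C.comp l h := by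
    rw [← hg, C.assoc, hl, C.lunit]
  rintro ⟨g, hg⟩ ⟨g', hg'⟩
  exact Subtype.ext ((cancel g hg).trans (cancel g' hg').symm)

theorem isoWitness_subsingleton (a b : IsoWitness C.toRTG f) : a = b :=
  Prod.ext ((rightNeutral_of_inverses a.1.2 a.2.2 x (C.Id x)).2 a.1 b.1)
    ((leftNeutral_of_inverses a.1.2 a.2.2 y (C.Id y)).2 a.2 b.2)

/-- Being neutral is equivalent to having a left and a right inverse. -/
def neutralEquivIsoWitness (f : C.Hom x y) :
    PLift (TransGraph.RightNeutral C.toWildSemicat.toTransGraph f ∧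
      TransGraph.LeftNeutral C.toWildSemicat.toTransGraph f) ≃ IsoWitness C.toRTG f where
  toFun n := ⟨Classical.choice (n.down.1 x (C.Id x)).1, Classical.choice (n.down.2 y (C.Id y)).1⟩
  invFun i := ⟨rightNeutral_of_inverses i.1.2 i.2.2, leftNeutral_of_inverses i.1.2 i.2.2⟩
  left_inv _ := rfl
  right_inv _ := isoWitness_subsingleton _ _

end WildPrecat

/-- In a wild precategory, `isNeutral f` is equivalent to `isIso f`; in
particular `isIso f` is a proposition. -/
theorem stmt_14 (C : WildPrecat.{u}) {x y : C.Ob} (f : C.Hom x y) :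
    Nonempty (PLift (TransGraph.RightNeutral C.toWildSemicat.toTransGraph f ∧
        TransGraph.LeftNeutral C.toWildSemicat.toTransGraph f) ≃
      IsoWitness C.toRTG f) ∧
    ∀ a b : IsoWitness C.toRTG f, a = b :=
  ⟨⟨WildPrecat.neutralEquivIsoWitness f⟩, WildPrecat.isoWitness_subsingleton⟩
end
end

section
/- Let A be a 3-restricted semi-Segal type and let x : Λ³₀ be an outer horn whose critical edge x₀₁ is neutral. Then x has contractible filling: the type of pairs (x₁₂₃, x₀₁₂₃) consisting of the missing triangle filler x₁₂₃ together with a tetrahedron filler x₀₁₂₃ of the completed boundary is contractible. -/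
set_option autoImplicit false
set_option linter.unusedVariables false

noncomputable section

universe u

/-- Triangle fillers of a given boundary are unique when `(2,1)`-horn filling is contractible. -/
theorem SST2.Horn21Contr.subsingleton_A2 {S : SST2.{u}} (h2 : S.Horn21Contr) {x0 x1 x2 : S.A0}
    {x01 : S.A1 x0 x1} {x12 : S.A1 x1 x2} {x02 : S.A1 x0 x2} (s t : S.A2 x01 x12 x02) :
    s = t := by
  simpa using (h2 x01 x12).2 ⟨x02, s⟩ ⟨x02, t⟩

/-- Tetrahedron fillers of a given boundary are unique when `(3,1)`-horn filling is
contractible. -/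
theorem SST3.Horn31Contr.subsingleton_A3 {S : SST3.{u}} (h3 : S.Horn31Contr)
    {x0 x1 x2 x3 : S.A0}
    {x01 : S.A1 x0 x1} {x12 : S.A1 x1 x2} {x23 : S.A1 x2 x3}
    {x02 : S.A1 x0 x2} {x13 : S.A1 x1 x3} {x03 : S.A1 x0 x3}
    {x012 : S.A2 x01 x12 x02} {x013 : S.A2 x01 x13 x03} {x023 : S.A2 x02 x23 x03}
    {x123 : S.A2 x12 x23 x13} (s t : S.A3 x012 x013 x023 x123) : s = t := by
  simpa using (h3 x012 x013 x123).2 ⟨x023, s⟩ ⟨x023, t⟩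

/-- In a 3-restricted semi-Segal type, a `Λ³₀`-horn whose critical edge `x01` is
neutral has contractible filling. -/
theorem stmt_15 (S : SST3.{u}) (h2 : SST2.Horn21Contr S.toSST2) (h3 : S.Horn31Contr)
    {x0 x1 x2 x3 : S.A0}
    {x01 : S.A1 x0 x1} {x12 : S.A1 x1 x2} {x23 : S.A1 x2 x3}
    {x02 : S.A1 x0 x2} {x13 : S.A1 x1 x3} {x03 : S.A1 x0 x3}
    (x012 : S.A2 x01 x12 x02) (x013 : S.A2 x01 x13 x03) (x023 : S.A2 x02 x23 x03)
    (hneutral : SST2.NeutralE S.toSST2 x01) :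
    IsContr ((x123 : S.A2 x12 x23 x13) × S.A3 x012 x013 x023 x123) := by
  have exists_x123 : Nonempty (S.A2 x12 x23 x13) := by
    obtain ⟨⟨y13, y123⟩⟩ := (h2 x12 x23).1
    obtain ⟨⟨y03, y013⟩⟩ := (h2 x01 y13).1
    obtain ⟨⟨y023, -⟩⟩ := (h3 x012 y013 y123).1
    obtain rfl : y03 = x03 := congrArg Sigma.fst ((h2 x02 x23).2 ⟨y03, y023⟩ ⟨x03, x023⟩)
    obtain rfl : y13 = x13 :=
      congrArg Sigma.fst ((hneutral.1 x3 y03).2 ⟨y13, y013⟩ ⟨x13, x013⟩)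
    exact ⟨y123⟩
  obtain ⟨x123⟩ := exists_x123
  obtain ⟨⟨y023, x0123⟩⟩ := (h3 x012 x013 x123).1
  obtain rfl := SST2.Horn21Contr.subsingleton_A2 h2 y023 x023
  refine ⟨⟨⟨x123, x0123⟩⟩, ?_⟩
  rintro ⟨s, p⟩ ⟨t, q⟩
  obtain rfl := SST2.Horn21Contr.subsingleton_A2 h2 s t
  rw [SST3.Horn31Contr.subsingleton_A3 h3 p q]
end
end
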